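/- arXiv:2501.06528 — 5 statements merged into one kernel-verified Lean document; each statement's English description precedes it below -/
import Mathlib

section
/- Let 0 < r_a < r_d and k = 1/√(r_d² − r_a²). Define φ(r) = ∫_{r_d}^{r} (k·√(σ² − r_a²)/σ − 1/σ) dσ. Then φ(r) ≥ 0 for every r ≥ r_a, φ(r_d) = 0, and φ(r) > 0 for every r ≥ r_a with r ≠ r_d. -/
open MeasureTheory intervalIntegral Real

noncomputable def phi (r_a r_d k r : ℝ) : ℝ :=
  ∫ σ in r_d..r, (k * Real.sqrt (σ ^ 2 - r_a ^ 2) / σ - 1 / σ)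

lemma intervalIntegrable_phi_integrand (r_a k : ℝ) {a b : ℝ} (ha : 0 < a) (hb : 0 < b) :
    IntervalIntegrable (fun σ ↦ k * Real.sqrt (σ ^ 2 - r_a ^ 2) / σ - 1 / σ) volume a b := by
  have hne : ∀ σ ∈ Set.uIcc a b, σ ≠ 0 := fun σ hσ ↦ ((lt_min ha hb).trans_le hσ.1).ne'
  apply ContinuousOn.intervalIntegrable
  exact (ContinuousOn.div (by fun_prop) continuousOn_id hne).sub
    (continuousOn_const.div continuousOn_id hne)

lemma phi_self (r_a r_d k : ℝ) : phi r_a r_d k r_d = 0 :=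
  intervalIntegral.integral_same

lemma phi_pos {r_a r_d r : ℝ} (h0 : 0 < r_a) (h1 : r_a < r_d) (hr : r_a ≤ r) (hne : r ≠ r_d) :
    0 < phi r_a r_d (1 / Real.sqrt (r_d ^ 2 - r_a ^ 2)) r := by
  have hd : 0 < r_d := h0.trans h1
  have hr0 : 0 < r := h0.trans_le hr
  have hs : 0 < Real.sqrt (r_d ^ 2 - r_a ^ 2) := Real.sqrt_pos.2 (by nlinarith)
  unfold phi
  rcases lt_or_gt_of_ne hne with h | h
  · rw [intervalIntegral.integral_symm, ← intervalIntegral.integral_neg]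
    refine intervalIntegral_pos_of_pos_on
      (intervalIntegrable_phi_integrand _ _ hr0 hd).neg (fun σ hσ ↦ ?_) h
    have hσ0 : 0 < σ := hr0.trans hσ.1
    rw [neg_sub, ← sub_div, one_div_mul_eq_div]
    refine div_pos (sub_pos.2 ((div_lt_one hs).2 ?_)) hσ0
    exact Real.sqrt_lt_sqrt (by nlinarith [hσ.1]) (by nlinarith [hσ.2])
  · refine intervalIntegral_pos_of_pos_on
      (intervalIntegrable_phi_integrand _ _ hd hr0) (fun σ hσ ↦ ?_) h
    have hσ0 : 0 < σ := hd.trans hσ.1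
    rw [← sub_div, one_div_mul_eq_div]
    refine div_pos (sub_pos.2 ((one_lt_div hs).2 ?_)) hσ0
    exact Real.sqrt_lt_sqrt (by nlinarith) (by nlinarith [hσ.1])

theorem stmt_0 (r_a r_d k : ℝ) (h0 : 0 < r_a) (h1 : r_a < r_d)
    (hk : k = 1 / Real.sqrt (r_d ^ 2 - r_a ^ 2)) :
    (∀ r, r_a ≤ r → 0 ≤ phi r_a r_d k r) ∧
    phi r_a r_d k r_d = 0 ∧
    (∀ r, r_a ≤ r → r ≠ r_d → 0 < phi r_a r_d k r) := by
  subst hk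
  refine ⟨fun r hr ↦ ?_, phi_self _ _ _, fun r hr hne ↦ phi_pos h0 h1 hr hne⟩
  rcases eq_or_ne r r_d with rfl | hne
  · exact (phi_self _ _ _).ge
  · exact (phi_pos h0 h1 hr hne).le
end

section
/- Let 0 < r_a < r_d and k = 1/√(r_d² − r_a²). Then for every r ≥ r_a, ∫_{r_d}^{r} (k·√(σ² − r_a²)/σ − 1/σ) dσ = k·(√(r² − r_a²) − √(r_d² − r_a²)) − k·r_a·(arctan(√(r² − r_a²)/r_a) − arctan(√(r_d² − r_a²)/r_a)) + ln(r_d/r). -/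
open MeasureTheory intervalIntegral Real

theorem hasDerivAt_sqrt_sub_arctan_sqrt {a x : ℝ} (ha : 0 < a) (hx : a < x) :
    HasDerivAt (fun y => √(y ^ 2 - a ^ 2) - a * arctan (√(y ^ 2 - a ^ 2) / a))
      (√(x ^ 2 - a ^ 2) / x) x := by
  have hpos : 0 < x ^ 2 - a ^ 2 := by nlinarith
  have hx0 : 0 < x := ha.trans hx
  have hs : HasDerivAt (fun y : ℝ => √(y ^ 2 - a ^ 2)) (x / √(x ^ 2 - a ^ 2)) x := by
    convert ((hasDerivAt_pow 2 x).sub_const (a ^ 2)).sqrt hpos.ne' using 1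
    norm_num
    field_simp
  have hsq : √(x ^ 2 - a ^ 2) ^ 2 = x ^ 2 - a ^ 2 := Real.sq_sqrt hpos.le
  have hs0 : 0 < √(x ^ 2 - a ^ 2) := Real.sqrt_pos.2 hpos
  refine (hs.sub (((hs.div_const a).arctan).const_mul a)).congr_deriv ?_
  have hden : 1 + (√(x ^ 2 - a ^ 2) / a) ^ 2 = x ^ 2 / a ^ 2 := by
    rw [div_pow, hsq]
    field_simp
    ring
  rw [hden]
  field_simp
  linarith

theorem stmt_2 (r_a r_d k : ℝ) (h0 : 0 < r_a) (h1 : r_a < r_d)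
    (hk : k = 1 / Real.sqrt (r_d ^ 2 - r_a ^ 2)) :
    ∀ r, r_a ≤ r →
      (∫ σ in r_d..r, (k * Real.sqrt (σ ^ 2 - r_a ^ 2) / σ - 1 / σ)) =
        k * (Real.sqrt (r ^ 2 - r_a ^ 2) - Real.sqrt (r_d ^ 2 - r_a ^ 2))
          - k * r_a * (Real.arctan (Real.sqrt (r ^ 2 - r_a ^ 2) / r_a)
              - Real.arctan (Real.sqrt (r_d ^ 2 - r_a ^ 2) / r_a))
          + Real.log (r_d / r) := by
  intro r hr
  have hne : ∀ x ∈ Set.uIcc r_d r, x ≠ 0 := fun x hx =>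
    (h0.trans_le ((le_min h1.le hr).trans hx.1)).ne'
  have hcont : ContinuousOn
      (fun y => k * (√(y ^ 2 - r_a ^ 2) - r_a * arctan (√(y ^ 2 - r_a ^ 2) / r_a)) - log y)
      (Set.uIcc r_d r) := by
    refine ContinuousOn.sub (Continuous.continuousOn ?_) (continuousOn_id.log hne)
    have := continuous_arctan
    fun_prop
  have hint : IntervalIntegrable (fun σ => k * √(σ ^ 2 - r_a ^ 2) / σ - 1 / σ) volume r_d r := by
    refine ContinuousOn.intervalIntegrable (ContinuousOn.sub ?_ ?_)
    · exact ContinuousOn.div (by fun_prop) continuousOn_id hne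
    · exact continuousOn_const.div continuousOn_id hne
  rw [integral_eq_sub_of_hasDeriv_right hcont (fun x hx => ?_) hint,
    log_div (h0.trans h1).ne' (h0.trans_le hr).ne']
  · ring
  · have hx' : r_a < x := (le_min h1.le hr).trans_lt hx.1
    rw [mul_div_assoc, one_div]
    exact (((hasDerivAt_sqrt_sub_arctan_sqrt h0 hx').const_mul k).sub
      (hasDerivAt_log (h0.trans hx').ne')).hasDerivWithinAt
end

section
/- Let V > 0, κ > 0, δ > 0, 0 < r_a < r_d, k = 1/√(r_d² − r_a²). Let r, θ : [0,∞) → ℝ be differentiable with r(t) ≥ r_a for all t ≥ 0, satisfying r'(t) = −V·cos θ(t) and θ'(t) = f(r(t), θ(t)) + V·sin θ(t)/r(t) for all t ≥ 0. Then the function t ↦ η(r(t), θ(t)) is differentiable with derivative equal to −κ·cos² θ(t)/(δ² − η(r(t),θ(t))²) at every t; in particular, if η(r(t),θ(t)) < δ for all t, this derivative is nonpositive for all t ≥ 0. -/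
open MeasureTheory intervalIntegral Real

noncomputable def eta (r_a r_d k r θ : ℝ) : ℝ := 1 - Real.sin θ + phi r_a r_d k r

/-- The proposed turn-rate control law outside the auxiliary circle. -/
noncomputable def ctrl (V κ δ r_a r_d k r θ : ℝ) : ℝ :=
  (V / r) * (1 - Real.sin θ) - k * V * Real.sqrt (r ^ 2 - r_a ^ 2) / r
    + κ * Real.cos θ / (δ ^ 2 - (eta r_a r_d k r θ) ^ 2)

theorem continuousOn_phi_integrand (a k : ℝ) :
    ContinuousOn (fun σ : ℝ => k * Real.sqrt (σ ^ 2 - a ^ 2) / σ - 1 / σ) (Set.Ioi 0) := by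
  have hne : ∀ σ ∈ Set.Ioi (0 : ℝ), σ ≠ 0 := fun σ hσ => ne_of_gt hσ
  exact (ContinuousOn.div (by fun_prop) continuousOn_id hne).sub
    (continuousOn_const.div continuousOn_id hne)

theorem hasDerivAt_phi {a d k x : ℝ} (hd : 0 < d) (hx : 0 < x) :
    HasDerivAt (phi a d k) (k * Real.sqrt (x ^ 2 - a ^ 2) / x - 1 / x) x := by
  have hc := continuousOn_phi_integrand a k
  refine intervalIntegral.integral_hasDerivAt_right ?_ ?_ ?_
  · exact (hc.mono fun y hy => lt_of_lt_of_le (lt_min hd hx) hy.1).intervalIntegrable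
  · exact hc.stronglyMeasurableAtFilter isOpen_Ioi x hx
  · exact hc.continuousAt (Ioi_mem_nhds hx)

theorem phi_nonneg {a d k x : ℝ} (ha : 0 < a) (had : a < d)
    (hk : k = 1 / Real.sqrt (d ^ 2 - a ^ 2)) (hx : 0 < x) : 0 ≤ phi a d k x := by
  have hs : 0 < Real.sqrt (d ^ 2 - a ^ 2) := Real.sqrt_pos.mpr (by nlinarith)
  unfold phi
  rcases le_total d x with h | h
  · refine intervalIntegral.integral_nonneg h fun σ hσ => ?_
    have hσ0 : 0 < σ := ha.trans (had.trans_le hσ.1)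
    rw [← sub_div]
    refine div_nonneg (sub_nonneg.mpr ?_) hσ0.le
    rw [hk, one_div_mul_eq_div, one_le_div hs]
    exact Real.sqrt_le_sqrt (by nlinarith [hσ.1])
  · rw [intervalIntegral.integral_symm, ← intervalIntegral.integral_neg]
    refine intervalIntegral.integral_nonneg h fun σ hσ => ?_
    have hσ0 : 0 < σ := hx.trans_le hσ.1
    rw [← sub_div, ← neg_div]
    refine div_nonneg (neg_nonneg.mpr (sub_nonpos.mpr ?_)) hσ0.le
    rw [hk, one_div_mul_eq_div, div_le_one hs]
    exact Real.sqrt_le_sqrt (by nlinarith [hσ.2])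

theorem eta_nonneg {a d k x : ℝ} (ha : 0 < a) (had : a < d)
    (hk : k = 1 / Real.sqrt (d ^ 2 - a ^ 2)) (hx : 0 < x) (θ : ℝ) : 0 ≤ eta a d k x θ :=
  add_nonneg (sub_nonneg.mpr (Real.sin_le_one θ)) (phi_nonneg ha had hk hx)

theorem stmt_4 (V κ δ r_a r_d k : ℝ) (hV : 0 < V) (hκ : 0 < κ) (hδ : 0 < δ)
    (h0 : 0 < r_a) (h1 : r_a < r_d) (hk : k = 1 / Real.sqrt (r_d ^ 2 - r_a ^ 2))
    (r θ : ℝ → ℝ)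
    (hra : ∀ t, 0 ≤ t → r_a ≤ r t)
    (hr : ∀ t, 0 ≤ t → HasDerivAt r (-V * Real.cos (θ t)) t)
    (hθ : ∀ t, 0 ≤ t →
      HasDerivAt θ (ctrl V κ δ r_a r_d k (r t) (θ t) + V * Real.sin (θ t) / r t) t) :
    (∀ t, 0 ≤ t →
      HasDerivAt (fun s => eta r_a r_d k (r s) (θ s))
        (-κ * (Real.cos (θ t)) ^ 2 / (δ ^ 2 - (eta r_a r_d k (r t) (θ t)) ^ 2)) t) ∧
    ((∀ t, 0 ≤ t → eta r_a r_d k (r t) (θ t) < δ) →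
      ∀ t, 0 ≤ t →
        -κ * (Real.cos (θ t)) ^ 2 / (δ ^ 2 - (eta r_a r_d k (r t) (θ t)) ^ 2) ≤ 0) := by
  have hpos : ∀ t, 0 ≤ t → 0 < r t := fun t ht => h0.trans_le (hra t ht)
  refine ⟨fun t ht => ?_, fun hlt t ht => ?_⟩
  · have hp := (hasDerivAt_phi (a := r_a) (k := k) (h0.trans h1) (hpos t ht)).comp t (hr t ht)
    have hη := ((hθ t ht).sin.const_sub 1).add hp
    refine hη.congr_deriv ?_
    unfold ctrl
    ring
  · have hη := eta_nonneg h0 h1 hk (hpos t ht) (θ t)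
    have hD : 0 ≤ δ ^ 2 - (eta r_a r_d k (r t) (θ t)) ^ 2 := by nlinarith [hlt t ht]
    refine div_nonpos_of_nonpos_of_nonneg ?_ hD
    nlinarith [mul_nonneg hκ.le (sq_nonneg (Real.cos (θ t)))]
end

section
/- Assume the radii satisfy Assumption 1: 0 < r_s < r_a < r_d, r_d < r_s + r_a, and r_a² > r_d·r_s. Let β = √(r_d² − r_a²)/r_a and Δ = arctan(β)/β + ln(r_d/r_a) − r_s/r_a. Then 0 < Δ < 1. -/
theorem arctan_lt_self_of_pos {b : ℝ} (hb : 0 < b) : Real.arctan b < b := by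
  have h := Real.lt_tan (Real.arctan_pos.2 hb) (Real.arctan_lt_pi_div_two b)
  rwa [Real.tan_arctan] at h

theorem div_sqrt_one_add_sq_lt_arctan {b : ℝ} (hb : 0 < b) :
    b / Real.sqrt (1 + b ^ 2) < Real.arctan b := by
  rw [← Real.sin_arctan]
  exact Real.sin_lt (Real.arctan_pos.2 hb)

theorem stmt_9 (r_s r_a r_d : ℝ)
    (h0 : 0 < r_s) (h1 : r_s < r_a) (h2 : r_a < r_d)
    (h3 : r_d < r_s + r_a) (h4 : r_d * r_s < r_a ^ 2) :
    0 < Real.arctan (Real.sqrt (r_d ^ 2 - r_a ^ 2) / r_a)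
          / (Real.sqrt (r_d ^ 2 - r_a ^ 2) / r_a)
        + Real.log (r_d / r_a) - r_s / r_a ∧
    Real.arctan (Real.sqrt (r_d ^ 2 - r_a ^ 2) / r_a)
          / (Real.sqrt (r_d ^ 2 - r_a ^ 2) / r_a)
        + Real.log (r_d / r_a) - r_s / r_a < 1 := by
  have ha : 0 < r_a := h0.trans h1
  have hd : 0 < r_d := ha.trans h2
  have hsq : 0 < r_d ^ 2 - r_a ^ 2 := by nlinarith
  set b := Real.sqrt (r_d ^ 2 - r_a ^ 2) / r_a with hb_def
  have hb : 0 < b := div_pos (Real.sqrt_pos.2 hsq) ha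
  have hx : Real.sqrt (1 + b ^ 2) = r_d / r_a := by
    rw [Real.sqrt_eq_iff_mul_self_eq_of_pos (div_pos hd ha), hb_def, div_pow,
      Real.sq_sqrt hsq.le]
    field_simp
    ring
  have hlog_pos : 0 < Real.log (r_d / r_a) := Real.log_pos ((one_lt_div ha).2 h2)
  have hlog_le := Real.log_le_sub_one_of_pos (div_pos hd ha)
  have hupper : Real.arctan b / b < 1 := (div_lt_one hb).2 (arctan_lt_self_of_pos hb)
  have hlower : r_a / r_d < Real.arctan b / b := by
    have h := div_sqrt_one_add_sq_lt_arctan hb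
    rw [hx, div_div_eq_mul_div, mul_div_assoc] at h
    rwa [lt_div_iff₀ hb, mul_comm]
  have hs_lt : r_s / r_a < r_a / r_d := by
    rw [div_lt_div_iff₀ ha hd]
    linarith
  have hs_gt : r_d / r_a < r_s / r_a + 1 := by
    rwa [← div_self ha.ne', ← add_div, div_lt_div_iff_of_pos_right ha]
  constructor <;> linarith
end

section
/- Let ρ > 0, let z : [0,∞) → ℝ be continuous with |z(0)| < ρ, and let B : ℝ → ℝ be a function that is continuous on the open interval (−ρ, ρ) and satisfies B(x) → ∞ as x → ρ from the left and as x → −ρ from the right. Suppose that for every t ≥ 0, if |z(s)| < ρ for all s ∈ [0, t], then B(z(t)) ≤ B(z(0)). Then |z(t)| < ρ for all t ≥ 0. -/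
open Filter Set

/-- A continuous real function on `[0, ∞)` that starts below `c` and later reaches `c` has a first
hitting time, at which it equals `c`. -/
lemma exists_first_hitting_time {f : ℝ → ℝ} {c t : ℝ} (hf : ContinuousOn f (Ici 0))
    (h0 : f 0 < c) (ht : 0 ≤ t) (hct : c ≤ f t) :
    ∃ T, 0 < T ∧ f T = c ∧ ∀ s ∈ Ico 0 T, f s < c := by
  have hcomp : IsCompact (Icc 0 t ∩ f ⁻¹' Ici c) :=
    isCompact_Icc.of_isClosed_subset
      ((hf.mono Icc_subset_Ici_self).preimage_isClosed_of_isClosed isClosed_Icc isClosed_Ici)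
      inter_subset_left
  obtain ⟨T, ⟨⟨hT0, hTt⟩, hTc⟩, hleast⟩ := hcomp.exists_isLeast ⟨t, ⟨ht, le_rfl⟩, hct⟩
  have hbelow : ∀ s ∈ Ico 0 T, f s < c := fun s hs => by
    by_contra! h
    exact (hleast ⟨⟨hs.1, hs.2.le.trans hTt⟩, h⟩).not_gt hs.2
  have hTpos : 0 < T := hT0.lt_of_ne (by rintro rfl; exact h0.not_ge hTc)
  obtain ⟨s, hs, hsc⟩ := intermediate_value_Icc hT0 (hf.mono Icc_subset_Ici_self) ⟨h0.le, hTc⟩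
  obtain rfl : s = T := by
    by_contra hne
    exact (hbelow s ⟨hs.1, hs.2.lt_of_ne hne⟩).ne hsc
  exact ⟨s, hTpos, hsc, hbelow⟩

theorem stmt_17 (ρ : ℝ) (hρ : 0 < ρ) (z : ℝ → ℝ) (B : ℝ → ℝ)
    (hz : ContinuousOn z (Set.Ici 0))
    (hz0 : |z 0| < ρ)
    (hB : ContinuousOn B (Set.Ioo (-ρ) ρ))
    (hBtop : Tendsto B (nhdsWithin ρ (Set.Iio ρ)) atTop)
    (hBbot : Tendsto B (nhdsWithin (-ρ) (Set.Ioi (-ρ))) atTop)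
    (hdec : ∀ t, 0 ≤ t → (∀ s ∈ Set.Icc 0 t, |z s| < ρ) → B (z t) ≤ B (z 0)) :
    ∀ t, 0 ≤ t → |z t| < ρ := by
  intro t ht
  by_contra! hct
  obtain ⟨T, hT, hzT, hlt⟩ := exists_first_hitting_time hz.abs hz0 ht hct
  have hlim : Tendsto z (nhdsWithin T (Ico 0 T)) (nhdsWithin (z T) (Ioo (-ρ) ρ)) :=
    ((hz T hT.le).mono Ico_subset_Ici_self).tendsto_nhdsWithin fun s hs => abs_lt.mp (hlt s hs)
  have hBlim : Tendsto B (nhdsWithin (z T) (Ioo (-ρ) ρ)) atTop := by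
    rcases (abs_eq hρ.le).mp hzT with h | h <;> rw [h]
    · exact hBtop.mono_left (nhdsWithin_mono _ Ioo_subset_Iio_self)
    · exact hBbot.mono_left (nhdsWithin_mono _ Ioo_subset_Ioi_self)
  have : (nhdsWithin T (Ico 0 T)).NeBot := by
    rw [nhdsWithin_Ico_eq_nhdsLT hT]
    infer_instance
  obtain ⟨s, hs, hgt⟩ :=
    (eventually_mem_nhdsWithin.and ((hBlim.comp hlim).eventually_gt_atTop (B (z 0)))).exists
  exact (hdec s hs.1 fun r hr => hlt r ⟨hr.1, hr.2.trans_lt hs.2⟩).not_gt hgt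
end
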